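/- arXiv:1204.0414 — 2 statements merged into one kernel-verified Lean document; each statement's English description precedes it below -/
import Mathlib

section
/- Let n ≥ 2 and, for k ∈ ℤ/nℤ, let H_k = {t ∈ [0,1]^n : 1/2 < t_k < 1 and 1/4 < t_{k+1} < 3/4} (indices modulo n), and let X = [0,1]^n \ ⋃_{k} H_k be the geometric model of the n dining philosophers program. Then the set of dihomotopy classes of total directed paths in X has exactly 2^n − 2 elements. -/
open Set

/-- A directed path in `Y ⊆ ℝⁿ`: a continuous map from the unit interval, all of whose
coordinate functions are monotone nondecreasing, with values in `Y`. -/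
def IsDiPath (n : ℕ) (Y : Set (Fin n → ℝ)) (p : unitInterval → Fin n → ℝ) : Prop :=
  Continuous p ∧ (∀ t, p t ∈ Y) ∧ ∀ j : Fin n, Monotone fun t => p t j

/-- A total directed path goes from `(0,…,0)` to `(1,…,1)`. -/
def IsTotalDiPath (n : ℕ) (Y : Set (Fin n → ℝ)) (p : unitInterval → Fin n → ℝ) : Prop :=
  IsDiPath n Y p ∧ p 0 = (fun _ => (0:ℝ)) ∧ p 1 = (fun _ => (1:ℝ))

/-- The unit cube `[0,1]^n`. -/
def cube (n : ℕ) : Set (Fin n → ℝ) := {z | ∀ j, z j ∈ Icc (0:ℝ) 1}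

/-- Elementary dihomotopy of directed paths with fixed common endpoints in `Y`. -/
def ElemDihomotopic (n : ℕ) (Y : Set (Fin n → ℝ)) (p q : unitInterval → Fin n → ℝ) : Prop :=
  IsDiPath n Y p ∧ IsDiPath n Y q ∧ p 0 = q 0 ∧ p 1 = q 1 ∧
  ∃ H : unitInterval → unitInterval → Fin n → ℝ,
    Continuous (fun tu : unitInterval × unitInterval => H tu.1 tu.2) ∧
    H 0 = p ∧ H 1 = q ∧ (∀ t, IsDiPath n Y (H t)) ∧
    ∀ (u : unitInterval) (j : Fin n), Monotone fun t => H t u j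

/-- Dihomotopy: equivalence relation generated by elementary dihomotopy. -/
def Dihomotopic (n : ℕ) (Y : Set (Fin n → ℝ)) :
    (unitInterval → Fin n → ℝ) → (unitInterval → Fin n → ℝ) → Prop :=
  Relation.EqvGen (ElemDihomotopic n Y)

lemma one_mem_of_closed_cover {F G : Set unitInterval} (hF : IsClosed F) (hG : IsClosed G)
    (hcover : ∀ u, u ∈ F ∨ u ∈ G) (hdisj : ∀ u, u ∈ F → u ∉ G) (h0 : 0 ∈ F) : 1 ∈ F := by
  have hFG : F = Gᶜ := by
    ext u
    exact ⟨hdisj u, fun h => (hcover u).resolve_right h⟩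
  have hclopen : IsClopen F := ⟨hF, hFG ▸ hG.isOpen_compl⟩
  rw [hclopen.eq_univ ⟨0, h0⟩]
  trivial

/-- A path avoiding the rectangle `(1/2,1) × (1/4,3/4)` goes either above or below it. -/
lemma above_or_below {a b : unitInterval → ℝ} (ha : Continuous a) (hb : Continuous b)
    (ha0 : a 0 = 0) (ha1 : a 1 = 1) (hb1 : b 1 = 1)
    (h : ∀ u, ¬ ((1/2 < a u ∧ a u < 1) ∧ (1/4 < b u ∧ b u < 3/4))) :
    (∃ u, a u ≤ 1/2 ∧ 3/4 ≤ b u) ∨ ∃ u, 1 ≤ a u ∧ b u ≤ 1/4 := by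
  by_contra! hcon
  obtain ⟨h1, h2⟩ := hcon
  have key := one_mem_of_closed_cover (F := {u | a u ≤ 1/2} ∪ {u | b u ≤ 1/4})
    (G := {u | 1 ≤ a u} ∪ {u | 3/4 ≤ b u})
    ((isClosed_le ha continuous_const).union (isClosed_le hb continuous_const))
    ((isClosed_le continuous_const ha).union (isClosed_le continuous_const hb))
    (fun u => by
      have := h u
      simp only [mem_union, mem_ofPred_eq]
      grind)
    (fun u => by
      have h1 := h1 u
      have h2 := h2 u
      simp only [mem_union, mem_ofPred_eq]
      grind)
    (Or.inl (by simp [ha0]))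
  simp only [mem_union, mem_ofPred_eq, ha1, hb1] at key
  norm_num at key

/-- The path `p` reaches `t j ≥ 3/4` before `t i > 1/2`. -/
def PassesAbove {n : ℕ} (p : unitInterval → Fin n → ℝ) (i j : Fin n) : Prop :=
  ∃ u, p u i ≤ 1/2 ∧ 3/4 ≤ p u j

/-- The path `p` reaches `t i = 1` before `t j > 1/4`. -/
def PassesBelow {n : ℕ} (p : unitInterval → Fin n → ℝ) (i j : Fin n) : Prop :=
  ∃ u, 1 ≤ p u i ∧ p u j ≤ 1/4

/-- The geometric model of the dining philosophers, for a given successor function. -/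
def philosophersSpace {n : ℕ} (nxt : Fin n → Fin n) : Set (Fin n → ℝ) :=
  cube n \ ⋃ k : Fin n, {t | (1/2 < t k ∧ t k < 1) ∧ (1/4 < t (nxt k) ∧ t (nxt k) < 3/4)}

lemma mem_philosophersSpace {n : ℕ} {nxt : Fin n → Fin n} {t : Fin n → ℝ} :
    t ∈ philosophersSpace nxt ↔ (∀ j, t j ∈ Icc (0:ℝ) 1) ∧
      ∀ k, ¬ ((1/2 < t k ∧ t k < 1) ∧ (1/4 < t (nxt k) ∧ t (nxt k) < 3/4)) := by
  simp only [philosophersSpace, cube, mem_sdiff, mem_iUnion, not_exists, mem_ofPred_eq]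

section Paths

variable {n : ℕ} {nxt : Fin n → Fin n} {p q : unitInterval → Fin n → ℝ}

lemma IsDiPath.continuous_apply {Y : Set (Fin n → ℝ)} (hp : IsDiPath n Y p) (j : Fin n) :
    Continuous fun u => p u j :=
  (_root_.continuous_apply j).comp hp.1

lemma not_above_and_below (hp : ∀ j : Fin n, Monotone fun t => p t j) {i j : Fin n}
    (ha : PassesAbove p i j) (hb : PassesBelow p i j) : False := by
  obtain ⟨u, hu1, hu2⟩ := ha
  obtain ⟨v, hv1, hv2⟩ := hb
  rcases le_total u v with h | h
  · have := hp j h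
    simp only at this
    linarith
  · have := hp i h
    simp only at this
    linarith

lemma IsTotalDiPath.above_or_below (hp : IsTotalDiPath n (philosophersSpace nxt) p) (k : Fin n) :
    PassesAbove p k (nxt k) ∨ PassesBelow p k (nxt k) := by
  obtain ⟨hd, h0, h1⟩ := hp
  exact _root_.above_or_below (hd.continuous_apply k) (hd.continuous_apply (nxt k))
    (by simp [h0]) (by simp [h1]) (by simp [h1])
    fun u => (mem_philosophersSpace.1 (hd.2.1 u)).2 k

lemma ElemDihomotopic.isTotalDiPath_iff {Y : Set (Fin n → ℝ)} (h : ElemDihomotopic n Y p q) :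
    IsTotalDiPath n Y p ↔ IsTotalDiPath n Y q := by
  obtain ⟨hp, hq, h0, h1, -⟩ := h
  simp [IsTotalDiPath, hp, hq, h0, h1]

lemma isClosed_setOf_exists {H : unitInterval → unitInterval → Fin n → ℝ}
    (hH : Continuous fun tu : unitInterval × unitInterval => H tu.1 tu.2) {C : Set (Fin n → ℝ)}
    (hC : IsClosed C) : IsClosed {t | ∃ u, H t u ∈ C} := by
  have := isClosedMap_fst_of_compactSpace (X := unitInterval) (Y := unitInterval) _
    (hC.preimage hH)
  convert this using 1
  ext t
  simp

/-- An elementary dihomotopy does not change on which side an obstacle is passed. -/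
lemma ElemDihomotopic.above_iff (h : ElemDihomotopic n (philosophersSpace nxt) p q)
    (hp : IsTotalDiPath n (philosophersSpace nxt) p) (k : Fin n) :
    PassesAbove p k (nxt k) ↔ PassesAbove q k (nxt k) := by
  have hq := h.isTotalDiPath_iff.1 hp
  obtain ⟨-, -, -, -, H, hH, hH0, hH1, hHd, hHm⟩ := h
  have htot : ∀ t, IsTotalDiPath n (philosophersSpace nxt) (H t) := by
    intro t
    refine ⟨hHd t, ?_, ?_⟩ <;> ext j
    · have h1 := hHm 0 j (unitInterval.nonneg' (t := t))
      have h2 := hHm 0 j (unitInterval.le_one' (t := t))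
      simp only [hH0, hH1, hp.2.1, hq.2.1] at h1 h2
      exact le_antisymm h2 h1
    · have h1 := hHm 1 j (unitInterval.nonneg' (t := t))
      have h2 := hHm 1 j (unitInterval.le_one' (t := t))
      simp only [hH0, hH1, hp.2.2, hq.2.2] at h1 h2
      exact le_antisymm h2 h1
  have hA : IsClosed {t | PassesAbove (H t) k (nxt k)} :=
    isClosed_setOf_exists hH (C := {x | x k ≤ 1/2 ∧ 3/4 ≤ x (nxt k)})
      ((isClosed_le (_root_.continuous_apply k) continuous_const).inter
        (isClosed_le continuous_const (_root_.continuous_apply (nxt k))))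
  have hB : IsClosed {t | PassesBelow (H t) k (nxt k)} :=
    isClosed_setOf_exists hH (C := {x | 1 ≤ x k ∧ x (nxt k) ≤ 1/4})
      ((isClosed_le continuous_const (_root_.continuous_apply k)).inter
        (isClosed_le (_root_.continuous_apply (nxt k)) continuous_const))
  have hcover := fun t => (htot t).above_or_below k
  have hdisj := fun t => not_above_and_below (hHd t).2.2 (i := k) (j := nxt k)
  have h1 := one_mem_of_closed_cover hA hB hcover (fun t => hdisj t)
  have h2 := one_mem_of_closed_cover hB hA (fun t => (hcover t).symm) (fun t hb ha => hdisj t ha hb)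
  simp only [mem_ofPred_eq, hH0, hH1] at h1 h2
  refine ⟨h1, fun hqa => (hp.above_or_below k).resolve_right fun hpb => ?_⟩
  exact not_above_and_below hq.1.2.2 hqa (h2 hpb)

lemma Dihomotopic.above_iff (h : Dihomotopic n (philosophersSpace nxt) p q) :
    (IsTotalDiPath n (philosophersSpace nxt) p ↔ IsTotalDiPath n (philosophersSpace nxt) q) ∧
      (IsTotalDiPath n (philosophersSpace nxt) p →
        ∀ k, PassesAbove p k (nxt k) ↔ PassesAbove q k (nxt k)) := by
  induction h with
  | rel p q h => exact ⟨h.isTotalDiPath_iff, h.above_iff⟩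
  | refl p => simp
  | symm p q _ ih => exact ⟨ih.1.symm, fun hq k => (ih.2 (ih.1.2 hq) k).symm⟩
  | trans p q r _ _ ih₁ ih₂ =>
    exact ⟨ih₁.1.trans ih₂.1, fun hp k => (ih₁.2 hp k).trans (ih₂.2 (ih₁.1.1 hp) k)⟩

/-- In a set closed under pointwise maxima, a path is elementarily dihomotopic to its maximum
with any other path with the same endpoints. -/
lemma elemDihomotopic_sup {Y Z : Set (Fin n → ℝ)} (hZY : Z ⊆ Y)
    (hZ : ∀ x ∈ Z, ∀ y ∈ Z, x ⊔ y ∈ Z)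
    (hp : IsTotalDiPath n Z p) (hq : IsTotalDiPath n Z q) :
    ElemDihomotopic n Y p (fun u => p u ⊔ q u) := by
  have hmono : ∀ t, ∀ j : Fin n, Monotone fun u => (p u ⊔ q (min u t)) j := by
    intro t j u v huv
    exact sup_le_sup (hp.1.2.2 j huv) (hq.1.2.2 j (min_le_min_right t huv))
  have hcont : Continuous fun tu : unitInterval × unitInterval =>
      p tu.2 ⊔ q (min tu.2 tu.1) :=
    continuous_pi fun j => ((hp.1.continuous_apply j).comp continuous_snd).sup
      ((hq.1.continuous_apply j).comp (continuous_snd.min continuous_fst))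
  have hdi : ∀ t, IsDiPath n Y fun u => p u ⊔ q (min u t) := fun t =>
    ⟨hcont.comp (Continuous.prodMk_right t), fun u => hZY (hZ _ (hp.1.2.1 _) _ (hq.1.2.1 _)),
      hmono t⟩
  have hstart : (fun u => p u ⊔ q (min u 0)) = p := by
    ext u j
    have h0 : min u 0 = 0 := min_eq_right unitInterval.nonneg'
    have hle : p 0 j ≤ p u j := hp.1.2.2 j (unitInterval.nonneg' (t := u))
    simpa [h0, hq.2.1, hp.2.1] using hle
  have hend : (fun u => p u ⊔ q (min u 1)) = fun u => p u ⊔ q u := by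
    ext u j
    rw [min_eq_left unitInterval.le_one']
  refine ⟨hstart ▸ hdi 0, hend ▸ hdi 1, ?_, ?_, fun t u => p u ⊔ q (min u t), hcont, hstart,
    hend, hdi, ?_⟩
  · simp [hp.2.1, hq.2.1]
  · simp [hp.2.2, hq.2.2]
  · intro u j s t hst
    exact sup_le_sup le_rfl (hq.1.2.2 j (min_le_min_left u hst))

/-- The part of the cube in which the obstacles in `S` are passed above and the others below. -/
def orderedSpace (nxt : Fin n → Fin n) (S : Set (Fin n)) : Set (Fin n → ℝ) :=
  {x | (∀ j, x j ∈ Icc (0:ℝ) 1) ∧ (∀ k ∈ S, x k ≤ 1/2 ∨ 3/4 ≤ x (nxt k)) ∧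
    ∀ k ∉ S, 1 ≤ x k ∨ x (nxt k) ≤ 1/4}

lemma orderedSpace_subset (S : Set (Fin n)) : orderedSpace nxt S ⊆ philosophersSpace nxt := by
  rintro x ⟨hx, hS, hS'⟩
  refine mem_philosophersSpace.2 ⟨hx, fun k hk => ?_⟩
  by_cases hkS : k ∈ S
  · rcases hS k hkS with h | h <;> linarith [hk.1.1, hk.2.2]
  · rcases hS' k hkS with h | h <;> linarith [hk.1.2, hk.2.1]

lemma sup_mem_orderedSpace (S : Set (Fin n)) :
    ∀ x ∈ orderedSpace nxt S, ∀ y ∈ orderedSpace nxt S, x ⊔ y ∈ orderedSpace nxt S := by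
  rintro x ⟨hx, hxS, hxS'⟩ y ⟨hy, hyS, hyS'⟩
  refine ⟨fun j => ⟨le_sup_of_le_left (hx j).1, sup_le (hx j).2 (hy j).2⟩,
    fun k hk => ?_, fun k hk => ?_⟩
  · have h1 := hxS k hk
    have h2 := hyS k hk
    simp only [Pi.sup_apply, sup_le_iff, le_sup_iff]
    tauto
  · have h1 := hxS' k hk
    have h2 := hyS' k hk
    simp only [Pi.sup_apply, sup_le_iff, le_sup_iff]
    tauto

lemma IsTotalDiPath.orderedSpace (hp : IsTotalDiPath n (philosophersSpace nxt) p) :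
    IsTotalDiPath n (orderedSpace nxt {k | PassesAbove p k (nxt k)}) p := by
  refine ⟨⟨hp.1.1, fun t => ⟨(mem_philosophersSpace.1 (hp.1.2.1 t)).1, fun k hk => ?_,
    fun k hk => ?_⟩, hp.1.2.2⟩, hp.2⟩
  · obtain ⟨u, hu1, hu2⟩ := hk
    rcases le_total t u with h | h
    · exact Or.inl ((hp.1.2.2 k h).trans hu1)
    · exact Or.inr (hu2.trans (hp.1.2.2 (nxt k) h))
  · obtain ⟨u, hu1, hu2⟩ := (hp.above_or_below k).resolve_left hk
    rcases le_total t u with h | h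
    · exact Or.inr ((hp.1.2.2 (nxt k) h).trans hu2)
    · exact Or.inl (hu1.trans (hp.1.2.2 k h))

/-- Total paths passing every obstacle on the same side are dihomotopic. -/
lemma dihomotopic_of_above_iff (hp : IsTotalDiPath n (philosophersSpace nxt) p)
    (hq : IsTotalDiPath n (philosophersSpace nxt) q)
    (h : {k | PassesAbove p k (nxt k)} = {k | PassesAbove q k (nxt k)}) :
    Dihomotopic n (philosophersSpace nxt) p q := by
  have hp' := hp.orderedSpace
  have hq' := hq.orderedSpace
  rw [← h] at hq'
  have hpq := elemDihomotopic_sup (orderedSpace_subset _) (sup_mem_orderedSpace _) hp' hq'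
  have hqp := elemDihomotopic_sup (orderedSpace_subset _) (sup_mem_orderedSpace _) hq' hp'
  simp only [sup_comm (q _)] at hqp
  exact .trans _ _ _ (.rel _ _ hpq) (.symm _ _ (.rel _ _ hqp))

/-- Starting times for the philosophers compatible with the prescribed order of neighbours. -/
lemma exists_schedule (hnxt : ∀ k : Fin n, (nxt k).val = (k.val + 1) % n) {S : Set (Fin n)}
    (hS : S ≠ ∅) (hS' : S ≠ univ) :
    ∃ f : Fin n → ℝ, (∀ k ∈ S, f (nxt k) + 1 ≤ f k) ∧ ∀ k ∉ S, f k + 1 ≤ f (nxt k) := by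
  classical
  set D : ℝ := ((Finset.univ.filter (· ∈ S)).card : ℝ) with hD
  set U : ℝ := ((Finset.univ.filter (· ∉ S)).card : ℝ) with hU
  have hD1 : 1 ≤ D := by
    obtain ⟨k, hk⟩ := nonempty_iff_ne_empty.2 hS
    exact Nat.one_le_cast.2 (Finset.card_pos.2 ⟨k, by simpa using hk⟩)
  have hU1 : 1 ≤ U := by
    obtain ⟨k, hk⟩ := (ne_univ_iff_exists_notMem S).1 hS'
    exact Nat.one_le_cast.2 (Finset.card_pos.2 ⟨k, by simpa using hk⟩)
  let w : Fin n → ℝ := fun i => if i ∈ S then -U else D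
  have hsum : ∑ i, w i = 0 := by
    simp only [w, Finset.sum_ite, Finset.sum_const, nsmul_eq_mul, ← hD, ← hU]
    ring
  let f : Fin n → ℝ := fun k => ∑ i with i.val < k.val, w i
  have hstep : ∀ k, f (nxt k) = f k + w k := by
    intro k
    have hinsert : f k + w k = ∑ i with i.val < k.val + 1, w i := by
      have : (Finset.univ.filter fun i : Fin n => i.val < k.val + 1)
          = insert k (Finset.univ.filter fun i : Fin n => i.val < k.val) := by
        ext i
        simp only [Finset.mem_filter, Finset.mem_univ, true_and, Finset.mem_insert, Fin.ext_iff]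
        omega
      rw [this, Finset.sum_insert (by simp), add_comm]
    rw [hinsert]
    simp only [f, hnxt]
    rcases Nat.lt_or_ge (k.val + 1) n with h | h
    · rw [Nat.mod_eq_of_lt h]
    · have hk : k.val + 1 = n := le_antisymm k.isLt h
      rw [hk, Nat.mod_self]
      simp [hsum]
  refine ⟨f, fun k hk => ?_, fun k hk => ?_⟩
  · rw [hstep]
    simp only [w, if_pos hk]
    linarith
  · rw [hstep]
    simp only [w, if_neg hk]
    linarith

variable [NeZero n]

lemma IsTotalDiPath.above_ne_univ (hp : IsTotalDiPath n (philosophersSpace nxt) p) :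
    {k | PassesAbove p k (nxt k)} ≠ univ := by
  intro h
  choose u hu1 hu2 using fun k => eq_univ_iff_forall.1 h k
  obtain ⟨k, hk⟩ := Finite.exists_min u
  have h1 : p (u k) (nxt k) ≤ p (u (nxt k)) (nxt k) := hp.1.2.2 (nxt k) (hk (nxt k))
  linarith [hu2 k, hu1 (nxt k)]

lemma IsTotalDiPath.above_ne_empty (hp : IsTotalDiPath n (philosophersSpace nxt) p) :
    {k | PassesAbove p k (nxt k)} ≠ ∅ := by
  intro h
  choose u hu1 hu2 using fun k =>
    (hp.above_or_below k).resolve_left (eq_empty_iff_forall_notMem.1 h k)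
  obtain ⟨k, hk⟩ := Finite.exists_max u
  have h1 : p (u (nxt k)) (nxt k) ≤ p (u k) (nxt k) := hp.1.2.2 (nxt k) (hk (nxt k))
  linarith [hu2 k, hu1 (nxt k)]

lemma exists_isTotalDiPath (hnxt : ∀ k : Fin n, (nxt k).val = (k.val + 1) % n)
    {S : Set (Fin n)} (hS : S ≠ ∅) (hS' : S ≠ univ) :
    ∃ p, IsTotalDiPath n (philosophersSpace nxt) p ∧ {k | PassesAbove p k (nxt k)} = S := by
  obtain ⟨f, hf, hf'⟩ := exists_schedule hnxt hS hS'
  obtain ⟨C, hC, hfC⟩ : ∃ C : ℝ, 0 ≤ C ∧ ∀ j, -C ≤ f j ∧ f j ≤ C := by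
    obtain ⟨m, hm⟩ := Finite.exists_max fun j => |f j|
    exact ⟨|f m|, abs_nonneg _, fun j => abs_le.1 (hm j)⟩
  let p : unitInterval → Fin n → ℝ := fun u j => max 0 (min ((2 * C + 1) * u - C - f j) 1)
  have hmem : ∀ u, p u ∈ orderedSpace nxt S := by
    intro u
    refine ⟨fun j => ⟨le_max_left _ _, max_le zero_le_one (min_le_right _ _)⟩,
      fun k hk => ?_, fun k hk => ?_⟩
    · have := hf k hk
      simp only [p]
      grind
    · have := hf' k hk
      simp only [p]
      grind
  refine ⟨p, ⟨⟨?_, fun u => orderedSpace_subset S (hmem u), ?_⟩, ?_, ?_⟩, ?_⟩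
  · fun_prop
  · intro j u v huv
    have huv' : (u : ℝ) ≤ v := huv
    simp only [p]
    gcongr
  · ext j
    have := hfC j
    simp only [p, Icc.coe_zero, mul_zero]
    exact max_eq_left (min_le_of_left_le (by linarith))
  · ext j
    have := hfC j
    simp only [p, Icc.coe_one, mul_one]
    rw [min_eq_right (by linarith), max_eq_right zero_le_one]
  · ext k
    constructor
    · rintro ⟨u, hu1, hu2⟩
      by_contra hk
      have := hf' k hk
      simp only [p] at hu1 hu2
      grind
    · intro hk
      have h := hf k hk
      have hb := hfC k
      have hpos : 0 < 2 * C + 1 := by linarith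
      refine ⟨⟨(f k + C) / (2 * C + 1), div_nonneg (by linarith) hpos.le,
        (div_le_one hpos).2 (by linarith)⟩, ?_⟩
      simp only [p, mul_div_cancel₀ _ hpos.ne']
      grind

end Paths

theorem stmt13 (n : ℕ) (hn : 2 ≤ n)
    (nxt : Fin n → Fin n) (hnxt : ∀ k : Fin n, (nxt k).val = (k.val + 1) % n)
    (X : Set (Fin n → ℝ))
    (hX : X = cube n \ ⋃ k : Fin n,
      {t | (1/2 < t k ∧ t k < 1) ∧ (1/4 < t (nxt k) ∧ t (nxt k) < 3/4)}) :
    Nat.card (Quot fun p q : {p : unitInterval → Fin n → ℝ // IsTotalDiPath n X p} =>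
      Dihomotopic n X p.1 q.1) = 2 ^ n - 2 := by
  have : NeZero n := ⟨by omega⟩
  obtain rfl : X = philosophersSpace nxt := hX
  let F : (Quot fun p q : {p : unitInterval → Fin n → ℝ //
      IsTotalDiPath n (philosophersSpace nxt) p} =>
      Dihomotopic n (philosophersSpace nxt) p.1 q.1) → Set (Fin n) :=
    Quot.lift (fun p => {k | PassesAbove p.1 k (nxt k)}) fun p q h =>
      Set.ext (h.above_iff.2 p.2)
  have hinj : Function.Injective F := by
    rintro ⟨p⟩ ⟨q⟩ h
    exact Quot.sound (dihomotopic_of_above_iff p.2 q.2 h)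
  have hrange : range F = {∅, univ}ᶜ := by
    ext S
    simp only [mem_range, mem_compl_iff, mem_insert_iff, mem_singleton_iff, not_or]
    constructor
    · rintro ⟨⟨p⟩, rfl⟩
      exact ⟨p.2.above_ne_empty, p.2.above_ne_univ⟩
    · rintro ⟨hS, hS'⟩
      obtain ⟨p, hp, hpS⟩ := exists_isTotalDiPath hnxt hS hS'
      exact ⟨Quot.mk _ ⟨p, hp⟩, hpS⟩
  rw [Nat.card_congr (Equiv.ofInjective F hinj), Nat.card_coe_set_eq, hrange, ncard_compl,
    ncard_pair empty_ne_univ, Nat.card_eq_fintype_card, Fintype.card_set, Fintype.card_fin]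
end

section
/- Let l ≥ 1 and let real numbers satisfy 0 < a_1 < a_2 < … < a_l < b_1 < b_2 < … < b_l < 1 (so consecutive squares overlap), and let X = [0,1]^2 \ ⋃_{m=1}^{l} (a_m, b_m)^2 be the geometric model of the two-phase locking program with 2 threads and l resources. Then the set of dihomotopy classes of total directed paths in X has exactly 2 elements, as for a square minus a single open square hole. -/
open Set

/-- The square `[0,1]^2` with the open squares `(a m, b m)^2` removed. -/
def squareMinusHoles {ι : Type*} (a b : ι → ℝ) : Set (Fin 2 → ℝ) :=
  cube 2 \ ⋃ m, {z | z 0 ∈ Ioo (a m) (b m) ∧ z 1 ∈ Ioo (a m) (b m)}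

/-- The path visits the quadrant `c ≤ z i`, `z j ≤ c`. -/
def VisitsQuadrant (c : ℝ) (i j : Fin 2) (p : unitInterval → Fin 2 → ℝ) : Prop :=
  ∃ u, c ≤ p u i ∧ p u j ≤ c

/-- For every hole, `(x, y)` lies below its lower edge or to the right of its right edge. -/
def BelowStairs {ι : Type*} (a b : ι → ℝ) (x y : ℝ) : Prop :=
  ∀ m, y ≤ a m ∨ b m ≤ x

/-- The planar path with `i`-th coordinate `x` and other coordinate `y`. -/
def pairPath (i : Fin 2) (x y : unitInterval → ℝ) : unitInterval → Fin 2 → ℝ :=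
  fun u k => if k = i then x u else y u

/-- The first coordinate of the boundary path `(0,0) → (1,0) → (1,1)`. -/
def firstLeg (u : unitInterval) : ℝ := min 1 (2 * (u : ℝ))

/-- The second coordinate of the boundary path `(0,0) → (1,0) → (1,1)`. -/
def secondLeg (u : unitInterval) : ℝ := max 0 (2 * (u : ℝ) - 1)

/-- A continuous monotone function from the unit interval onto `[0,1]`. -/
def IsClimb (x : unitInterval → ℝ) : Prop :=
  Continuous x ∧ Monotone x ∧ x 0 = 0 ∧ x 1 = 1

lemma IsClimb.mem_Icc {x : unitInterval → ℝ} (hx : IsClimb x) (u : unitInterval) :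
    x u ∈ Icc (0 : ℝ) 1 :=
  ⟨hx.2.2.1 ▸ hx.2.1 u.2.1, hx.2.2.2 ▸ hx.2.1 u.2.2⟩

lemma IsClimb.max {x y : unitInterval → ℝ} (hx : IsClimb x) (hy : IsClimb y) :
    IsClimb fun u => max (x u) (y u) :=
  ⟨hx.1.max hy.1, hx.2.1.max hy.2.1, by simp [hx.2.2.1, hy.2.2.1], by simp [hx.2.2.2, hy.2.2.2]⟩

lemma IsClimb.min {x y : unitInterval → ℝ} (hx : IsClimb x) (hy : IsClimb y) :
    IsClimb fun u => min (x u) (y u) :=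
  ⟨hx.1.min hy.1, hx.2.1.min hy.2.1, by simp [hx.2.2.1, hy.2.2.1], by simp [hx.2.2.2, hy.2.2.2]⟩

lemma isClimb_firstLeg : IsClimb firstLeg := by
  refine ⟨by unfold firstLeg; fun_prop, fun u v h => ?_, by simp [firstLeg], by norm_num [firstLeg]⟩
  have h' : (u : ℝ) ≤ v := h
  unfold firstLeg
  gcongr

lemma isClimb_secondLeg : IsClimb secondLeg := by
  refine ⟨by unfold secondLeg; fun_prop, fun u v h => ?_, by simp [secondLeg],
    by norm_num [secondLeg]⟩
  have h' : (u : ℝ) ≤ v := h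
  unfold secondLeg
  gcongr

lemma secondLeg_eq_zero_or_firstLeg_eq_one (u : unitInterval) :
    secondLeg u = 0 ∨ firstLeg u = 1 := by
  rcases le_total (2 * (u : ℝ)) 1 with h | h
  · exact Or.inl (max_eq_left (by linarith))
  · exact Or.inr (min_eq_left h)

lemma eq_or_eq_of_ne {i j : Fin 2} (hij : i ≠ j) (k : Fin 2) : k = i ∨ k = j := by
  omega

lemma IsTotalDiPath.isClimb {Y : Set (Fin 2 → ℝ)} {p : unitInterval → Fin 2 → ℝ}
    (hp : IsTotalDiPath 2 Y p) (k : Fin 2) : IsClimb fun u => p u k :=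
  ⟨(continuous_apply k).comp hp.1.1, hp.1.2.2 k, by simp [hp.2.1], by simp [hp.2.2]⟩

lemma pairPath_eq {i j : Fin 2} (hij : i ≠ j) (p : unitInterval → Fin 2 → ℝ) :
    pairPath i (fun u => p u i) (fun u => p u j) = p := by
  funext u k
  rcases eq_or_eq_of_ne hij k with rfl | rfl
  · simp [pairPath]
  · simp [pairPath, hij.symm]

lemma avoids_hole {ι : Type*} {a b : ι → ℝ} {i j : Fin 2} (hij : i ≠ j) {z : Fin 2 → ℝ}
    (hz : z ∈ squareMinusHoles a b) (m : ι) (hi : z i ∈ Ioo (a m) (b m))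
    (hj : z j ∈ Ioo (a m) (b m)) : False := by
  refine hz.2 (mem_iUnion.2 ⟨m, ?_, ?_⟩)
  · rcases eq_or_eq_of_ne hij 0 with h | h <;> rw [h] <;> assumption
  · rcases eq_or_eq_of_ne hij 1 with h | h <;> rw [h] <;> assumption

lemma BelowStairs.mono {ι : Type*} {a b : ι → ℝ} {x y x' y' : ℝ} (h : BelowStairs a b x y)
    (hx : x ≤ x') (hy : y' ≤ y) : BelowStairs a b x' y' := fun m =>
  (h m).imp hy.trans (fun h' => h'.trans hx)

lemma mem_squareMinusHoles_of_belowStairs {ι : Type*} {a b : ι → ℝ} {i j : Fin 2}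
    {z : Fin 2 → ℝ} (hz : z ∈ cube 2) (h : BelowStairs a b (z i) (z j)) :
    z ∈ squareMinusHoles a b := by
  refine ⟨hz, fun hz' => ?_⟩
  obtain ⟨m, h0, h1⟩ := mem_iUnion.1 hz'
  have key : ∀ k, z k ∈ Ioo (a m) (b m) := by
    intro k
    fin_cases k <;> assumption
  rcases h m with h | h
  · exact absurd (key j).1 h.not_gt
  · exact absurd (key i).2 h.not_gt

lemma isTotalDiPath_pairPath {ι : Type*} {a b : ι → ℝ} {i j : Fin 2} (hij : i ≠ j)
    {x y : unitInterval → ℝ} (hx : IsClimb x) (hy : IsClimb y)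
    (h : ∀ u, BelowStairs a b (x u) (y u)) :
    IsTotalDiPath 2 (squareMinusHoles a b) (pairPath i x y) := by
  refine ⟨⟨?_, fun u => ?_, fun k => ?_⟩, ?_, ?_⟩
  · refine continuous_pi fun k => ?_
    by_cases hk : k = i
    · simpa [pairPath, hk] using hx.1
    · simpa [pairPath, hk] using hy.1
  · refine mem_squareMinusHoles_of_belowStairs (i := i) (j := j) (fun k => ?_) ?_
    · by_cases hk : k = i
      · simpa [pairPath, hk] using hx.mem_Icc u
      · simpa [pairPath, hk] using hy.mem_Icc u
    · simpa [pairPath, hij.symm] using h u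
  · by_cases hk : k = i
    · simpa [pairPath, hk] using hx.2.1
    · simpa [pairPath, hk] using hy.2.1
  · funext k
    simp [pairPath, hx.2.2.1, hy.2.2.1]
  · funext k
    simp [pairPath, hx.2.2.2, hy.2.2.2]

lemma IsClimb.interp {x x' : unitInterval → ℝ} (hx : IsClimb x) (hx' : IsClimb x')
    (t : unitInterval) : IsClimb fun u => (1 - (t : ℝ)) * x u + t * x' u := by
  have h0 : (0 : ℝ) ≤ t := t.2.1
  have h1 : (0 : ℝ) ≤ 1 - t := by linarith [t.2.2]
  refine ⟨(hx.1.const_mul _).add (hx'.1.const_mul _), fun u v h => ?_, ?_, ?_⟩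
  · have := hx.2.1 h
    have := hx'.2.1 h
    dsimp only
    gcongr
  · simp [hx.2.2.1, hx'.2.2.1]
  · simp [hx.2.2.2, hx'.2.2.2]

/-- Straight-line interpolation stays below the stairs if the corner `(x, y')` does. -/
lemma elemDihomotopic_pairPath {ι : Type*} {a b : ι → ℝ} {i j : Fin 2} (hij : i ≠ j)
    {x y x' y' : unitInterval → ℝ} (hx : IsClimb x) (hy : IsClimb y) (hx' : IsClimb x')
    (hy' : IsClimb y') (hxx : x ≤ x') (hyy : y ≤ y')
    (h : ∀ u, BelowStairs a b (x u) (y' u)) :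
    ElemDihomotopic 2 (squareMinusHoles a b) (pairPath i x y) (pairPath i x' y') := by
  have hp := isTotalDiPath_pairPath hij hx hy fun u => (h u).mono le_rfl (hyy u)
  have hq := isTotalDiPath_pairPath hij hx' hy' fun u => (h u).mono (hxx u) le_rfl
  have interp_mono : ∀ {r s : ℝ}, r ≤ s →
      Monotone fun t : unitInterval => (1 - (t : ℝ)) * r + t * s := by
    intro r s hrs t t' htt
    have : (t : ℝ) ≤ t' := htt
    dsimp only
    nlinarith [mul_le_mul_of_nonneg_right this (sub_nonneg.2 hrs)]
  refine ⟨hp.1, hq.1, hp.2.1.trans hq.2.1.symm, hp.2.2.trans hq.2.2.symm,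
    fun t => pairPath i (fun u => (1 - (t : ℝ)) * x u + t * x' u)
      (fun u => (1 - (t : ℝ)) * y u + t * y' u), ?_, ?_, ?_, fun t => ?_, fun u k => ?_⟩
  · have := hx.1
    have := hx'.1
    have := hy.1
    have := hy'.1
    refine continuous_pi fun k => ?_
    by_cases hk : k = i
    · simp only [pairPath, hk, if_true]
      fun_prop
    · simp only [pairPath, hk, if_false]
      fun_prop
  · simp
  · simp
  · refine (isTotalDiPath_pairPath hij (hx.interp hx' t) (hy.interp hy' t) fun u => ?_).1
    have hl := interp_mono (hxx u) (show 0 ≤ t from t.2.1)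
    have hr := interp_mono (hyy u) (show t ≤ 1 from t.2.2)
    refine (h u).mono ?_ ?_
    · simpa using hl
    · simpa using hr
  · by_cases hk : k = i
    · simpa only [pairPath, hk, if_true] using interp_mono (hxx u)
    · simpa only [pairPath, hk, if_false] using interp_mono (hyy u)

section Holes

variable {ι : Type*} {a b : ι → ℝ} {c : ℝ} {i j : Fin 2} {p q : unitInterval → Fin 2 → ℝ}

lemma belowStairs_of_visitsQuadrant (hij : i ≠ j) (hc : ∀ m, c ∈ Ioo (a m) (b m)) (hc0 : 0 ≤ c)
    (hp : IsTotalDiPath 2 (squareMinusHoles a b) p) (hv : VisitsQuadrant c i j p)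
    (u : unitInterval) : BelowStairs a b (p u i) (p u j) := by
  have hi := hp.isClimb i
  have hj := hp.isClimb j
  obtain ⟨w, hwi, hwj⟩ := hv
  obtain ⟨v, hv, hvi : p v i = c⟩ := intermediate_value_Icc (show 0 ≤ w from w.2.1) hi.1.continuousOn
    (show c ∈ Icc (p 0 i) (p w i) from ⟨hi.2.2.1.trans_le hc0, hwi⟩)
  have hvc : p v j ≤ c := (hj.2.1 hv.2).trans hwj
  intro m
  have hvm : p v j ≤ a m := by
    by_contra! h
    exact avoids_hole hij (hp.1.2.1 v) m (hvi ▸ hc m) ⟨h, hvc.trans_lt (hc m).2⟩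
  rcases le_total u v with huv | hvu
  · exact Or.inl ((hj.2.1 huv).trans hvm)
  · by_contra! h
    obtain ⟨r, hr, hrj : p r j = min (p u j) c⟩ := intermediate_value_Icc hvu hj.1.continuousOn
      (show min (p u j) c ∈ Icc (p v j) (p u j) from
        ⟨le_min (hj.2.1 hvu) hvc, min_le_left _ _⟩)
    refine avoids_hole hij (hp.1.2.1 r) m ⟨?_, (hi.2.1 hr.2).trans_lt h.2⟩ ?_
    · exact (hc m).1.trans_le (hvi.symm.trans_le (hi.2.1 hr.1))
    · rw [hrj]
      exact ⟨lt_min h.1 (hc m).1, (min_le_right _ _).trans_lt (hc m).2⟩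

lemma belowStairs_legs (ha : ∀ m, 0 ≤ a m) (hb : ∀ m, b m ≤ 1) (u : unitInterval) :
    BelowStairs a b (firstLeg u) (secondLeg u) := fun m =>
  (secondLeg_eq_zero_or_firstLeg_eq_one u).imp (fun h => h.trans_le (ha m))
    (fun h => (hb m).trans h.ge)

lemma dihomotopic_legs_of_visitsQuadrant (hij : i ≠ j) (ha : ∀ m, 0 ≤ a m) (hb : ∀ m, b m ≤ 1)
    (hc : ∀ m, c ∈ Ioo (a m) (b m)) (hc0 : 0 ≤ c)
    (hp : IsTotalDiPath 2 (squareMinusHoles a b) p) (hv : VisitsQuadrant c i j p) :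
    Dihomotopic 2 (squareMinusHoles a b) p (pairPath i firstLeg secondLeg) := by
  have hstairs := belowStairs_of_visitsQuadrant hij hc hc0 hp hv
  have hlegs := belowStairs_legs ha hb
  have hi := hp.isClimb i
  have hj := hp.isClimb j
  have hf := isClimb_firstLeg
  have hs := isClimb_secondLeg
  have hright := elemDihomotopic_pairPath hij hi hj (hi.max hf) hj
    (fun _ => le_max_left _ _) le_rfl hstairs
  have hdown := elemDihomotopic_pairPath hij (hi.max hf) (hj.min hs) (hi.max hf) hj le_rfl
    (fun _ => min_le_left _ _) fun u => (hstairs u).mono (le_max_left _ _) le_rfl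
  have hleft := elemDihomotopic_pairPath hij hf (hj.min hs) (hi.max hf) (hj.min hs)
    (fun _ => le_max_right _ _) le_rfl fun u => (hlegs u).mono le_rfl (min_le_right _ _)
  have hup := elemDihomotopic_pairPath hij hf (hj.min hs) hf hs le_rfl
    (fun _ => min_le_right _ _) hlegs
  rw [pairPath_eq hij] at hright
  exact (Relation.EqvGen.rel _ _ hright).trans _ _ _ <|
    ((Relation.EqvGen.rel _ _ hdown).symm _ _).trans _ _ _ <|
    ((Relation.EqvGen.rel _ _ hleft).symm _ _).trans _ _ _ (Relation.EqvGen.rel _ _ hup)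

lemma visitsQuadrant_or (hc : c ∈ Icc (0 : ℝ) 1)
    (hp : IsTotalDiPath 2 (squareMinusHoles a b) p) :
    VisitsQuadrant c i j p ∨ VisitsQuadrant c j i p := by
  have hi := hp.isClimb i
  obtain ⟨v, -, hv : p v i = c⟩ := intermediate_value_Icc zero_le_one hi.1.continuousOn
    (show c ∈ Icc (p 0 i) (p 1 i) from ⟨hi.2.2.1.trans_le hc.1, hc.2.trans hi.2.2.2.ge⟩)
  rcases le_total (p v j) c with h | h
  · exact Or.inl ⟨v, hv.ge, h⟩
  · exact Or.inr ⟨v, h, hv.le⟩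

lemma not_visitsQuadrant_of_swap [Nonempty ι] (hij : i ≠ j) (hc : ∀ m, c ∈ Ioo (a m) (b m))
    (hc0 : 0 ≤ c) (hp : IsTotalDiPath 2 (squareMinusHoles a b) p)
    (hv : VisitsQuadrant c i j p) : ¬ VisitsQuadrant c j i p := by
  rintro ⟨u, hj, hi⟩
  obtain ⟨m⟩ := ‹Nonempty ι›
  rcases belowStairs_of_visitsQuadrant hij hc hc0 hp hv u m with h | h
  · linarith [(hc m).1]
  · linarith [(hc m).2]

lemma visitsQuadrant_iff_of_elemDihomotopic [Nonempty ι] (hij : i ≠ j)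
    (hc : ∀ m, c ∈ Ioo (a m) (b m)) (hc01 : c ∈ Icc (0 : ℝ) 1)
    (hpq : ElemDihomotopic 2 (squareMinusHoles a b) p q) :
    (IsTotalDiPath 2 (squareMinusHoles a b) p ∧ VisitsQuadrant c i j p) ↔
      (IsTotalDiPath 2 (squareMinusHoles a b) q ∧ VisitsQuadrant c i j q) := by
  obtain ⟨hp, hq, h0, h1, H, hH, rfl, rfl, hdi, hmono⟩ := hpq
  have htotal : IsTotalDiPath 2 (squareMinusHoles a b) (H 0) ∨
      IsTotalDiPath 2 (squareMinusHoles a b) (H 1) →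
      ∀ t, IsTotalDiPath 2 (squareMinusHoles a b) (H t) := by
    intro h t
    have hends : H 0 0 = (fun _ => 0) ∧ H 0 1 = fun _ => 1 := by
      rcases h with h | h
      · exact h.2
      · exact ⟨h0.trans h.2.1, h1.trans h.2.2⟩
    have hconst : ∀ u, H 0 u = H 1 u → H t u = H 0 u := fun u hu => funext fun k =>
      le_antisymm ((hmono u k t.2.2).trans (congrFun hu k).ge) (hmono u k t.2.1)
    exact ⟨hdi t, (hconst 0 h0).trans hends.1, (hconst 1 h1).trans hends.2⟩
  have hclosed : ∀ k k' : Fin 2, IsClosed {t | VisitsQuadrant c k k' (H t)} := by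
    intro k k'
    have hS : IsClosed {tu : unitInterval × unitInterval |
        c ≤ H tu.1 tu.2 k ∧ H tu.1 tu.2 k' ≤ c} :=
      (isClosed_le continuous_const ((continuous_apply k).comp hH)).inter
        (isClosed_le ((continuous_apply k').comp hH) continuous_const)
    convert isClosedMap_fst_of_compactSpace _ hS using 1
    ext t
    simp [VisitsQuadrant]
  have hspread : ∀ t t', (∀ s, IsTotalDiPath 2 (squareMinusHoles a b) (H s)) →
      VisitsQuadrant c i j (H t) → VisitsQuadrant c i j (H t') := by
    intro t t' htot ht
    by_contra ht'
    obtain ⟨s, -, hs, hs'⟩ := isPreconnected_closed_iff.1 isPreconnected_univ _ _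
      (hclosed i j) (hclosed j i) (fun s _ => visitsQuadrant_or hc01 (htot s))
      ⟨t, trivial, ht⟩ ⟨t', trivial, (visitsQuadrant_or hc01 (htot t')).resolve_left ht'⟩
    exact not_visitsQuadrant_of_swap hij hc hc01.1 (htot s) hs hs'
  constructor
  · rintro ⟨h, hv⟩
    have htot := htotal (Or.inl h)
    exact ⟨htot 1, hspread 0 1 htot hv⟩
  · rintro ⟨h, hv⟩
    have htot := htotal (Or.inr h)
    exact ⟨htot 0, hspread 1 0 htot hv⟩

lemma visitsQuadrant_iff_of_dihomotopic [Nonempty ι] (hij : i ≠ j)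
    (hc : ∀ m, c ∈ Ioo (a m) (b m)) (hc01 : c ∈ Icc (0 : ℝ) 1)
    (hpq : Dihomotopic 2 (squareMinusHoles a b) p q) :
    (IsTotalDiPath 2 (squareMinusHoles a b) p ∧ VisitsQuadrant c i j p) ↔
      (IsTotalDiPath 2 (squareMinusHoles a b) q ∧ VisitsQuadrant c i j q) := by
  induction hpq with
  | rel _ _ h => exact visitsQuadrant_iff_of_elemDihomotopic hij hc hc01 h
  | refl => exact Iff.rfl
  | symm _ _ _ ih => exact ih.symm
  | trans _ _ _ _ _ ih ih' => exact ih.trans ih'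

lemma visitsQuadrant_legs (hij : i ≠ j) (hc01 : c ∈ Icc (0 : ℝ) 1) :
    VisitsQuadrant c i j (pairPath i firstLeg secondLeg) := by
  refine ⟨⟨1 / 2, by norm_num, by norm_num⟩, ?_, ?_⟩
  · simpa [pairPath, firstLeg] using hc01.2
  · simpa [pairPath, secondLeg, hij.symm] using hc01.1

/-- Open square holes with a common diagonal point leave exactly two dihomotopy classes of total
directed paths. -/
lemma card_dihomotopy_classes [Nonempty ι] (ha : ∀ m, 0 ≤ a m) (hb : ∀ m, b m ≤ 1)
    (hc : ∀ m, c ∈ Ioo (a m) (b m)) (hc01 : c ∈ Icc (0 : ℝ) 1) :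
    Nat.card (Quot fun p q : {p : unitInterval → Fin 2 → ℝ //
      IsTotalDiPath 2 (squareMinusHoles a b) p} =>
        Dihomotopic 2 (squareMinusHoles a b) p.1 q.1) = 2 := by
  have h01 : (0 : Fin 2) ≠ 1 := by decide
  have hlegs : ∀ {i j : Fin 2}, i ≠ j →
      IsTotalDiPath 2 (squareMinusHoles a b) (pairPath i firstLeg secondLeg) := fun h =>
    isTotalDiPath_pairPath h isClimb_firstLeg isClimb_secondLeg (belowStairs_legs ha hb)
  refine Nat.card_eq_two_iff.2 ⟨Quot.mk _ ⟨_, hlegs h01⟩, Quot.mk _ ⟨_, hlegs h01.symm⟩,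
    fun h => ?_, eq_univ_of_forall fun z => ?_⟩
  · have hinv := congrArg (Quot.lift (fun p => VisitsQuadrant c 0 1 p.1) fun p q hpq => by
      simpa [p.2, q.2] using visitsQuadrant_iff_of_dihomotopic h01 hc hc01 hpq) h
    exact not_visitsQuadrant_of_swap h01.symm hc hc01.1 (hlegs h01.symm)
      (visitsQuadrant_legs h01.symm hc01) (hinv.mp (visitsQuadrant_legs h01 hc01))
  · obtain ⟨p, hp⟩ := z
    rcases visitsQuadrant_or (i := 0) (j := 1) hc01 hp with hv | hv
    · exact Or.inl (Quot.sound (dihomotopic_legs_of_visitsQuadrant h01 ha hb hc hc01.1 hp hv))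
    · exact Or.inr
        (Quot.sound (dihomotopic_legs_of_visitsQuadrant h01.symm ha hb hc hc01.1 hp hv))

end Holes

theorem stmt15 (l : ℕ) (hl : 1 ≤ l) (a b : Fin l → ℝ)
    (hma : StrictMono a) (hmb : StrictMono b)
    (ha0 : 0 < a ⟨0, by omega⟩)
    (hab : a ⟨l - 1, by omega⟩ < b ⟨0, by omega⟩)
    (hb1 : b ⟨l - 1, by omega⟩ < 1)
    (X : Set (Fin 2 → ℝ))
    (hX : X = cube 2 \ ⋃ m : Fin l, {z | z 0 ∈ Ioo (a m) (b m) ∧ z 1 ∈ Ioo (a m) (b m)}) :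
    Nat.card (Quot fun p q : {p : unitInterval → Fin 2 → ℝ // IsTotalDiPath 2 X p} =>
      Dihomotopic 2 X p.1 q.1) = 2 := by
  have hpos : ∀ m, 0 < a m := fun m =>
    ha0.trans_le (hma.monotone (Fin.mk_le_of_le_val (Nat.zero_le _)))
  have hlt : ∀ m, b m < 1 := fun m =>
    (hmb.monotone (Fin.mk_le_mk.2 (by omega : m.1 ≤ l - 1))).trans_lt hb1
  obtain ⟨c, hac, hcb⟩ := exists_between hab
  have hc : ∀ m, c ∈ Ioo (a m) (b m) := fun m =>
    ⟨(hma.monotone (Fin.mk_le_mk.2 (by omega : m.1 ≤ l - 1))).trans_lt hac,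
      hcb.trans_le (hmb.monotone (Fin.mk_le_of_le_val (Nat.zero_le _)))⟩
  have : Nonempty (Fin l) := ⟨⟨0, hl⟩⟩
  subst hX
  exact card_dihomotopy_classes (fun m => (hpos m).le) (fun m => (hlt m).le) hc
    ⟨((hpos _).trans hac).le, (hcb.trans (hlt _)).le⟩
end
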